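/- For every subgroup H of a free group F_r of finite rank, there exists a unique minimal (with respect to inclusion) verbally closed subgroup vcl(H) of F_r containing H; it coincides with the unique minimal algebraically closed subgroup containing H. -/

import Mathlib

/-- Evaluation of a word with variables `Fin n` and constants from `H`
at an assignment `x : Fin n → G`. -/
def evalWord {G : Type*} [Group G] (H : Subgroup G) {n : ℕ}
    (x : Fin n → G) : FreeGroup (Fin n ⊕ H) →* G :=
  FreeGroup.lift (Sum.elim x (fun h => (h : G)))
/-- `H` is algebraically closed in `G`: every finite system of equations with
constants from `H` solvable in `G` is solvable in `H`. -/
def AlgClosedIn {G : Type*} [Group G] (H : Subgroup G) : Prop :=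
  ∀ (n m : ℕ) (S : Fin m → FreeGroup (Fin n ⊕ H)),
    (∃ x : Fin n → G, ∀ i, evalWord H x (S i) = 1) →
    (∃ x : Fin n → G, (∀ j, x j ∈ H) ∧ ∀ i, evalWord H x (S i) = 1)
/-- `H` is verbally closed in `G`: for every word `w` and `h ∈ H`, if the
equation `w(x₁,…,xₙ) = h` has a solution in `G` then it has one in `H`. -/
def VerballyClosedIn {G : Type*} [Group G] (H : Subgroup G) : Prop :=
  ∀ (n : ℕ) (w : FreeGroup (Fin n)) (h : G), h ∈ H →
    (∃ x : Fin n → G, FreeGroup.lift x w = h) →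
    (∃ x : Fin n → G, (∀ j, x j ∈ H) ∧ FreeGroup.lift x w = h)

section Hopfian

theorem FreeGroup.finite_setOf_norm_le (ι : Type*) [Finite ι] [DecidableEq ι] (n : ℕ) :
    {g : FreeGroup ι | g.norm ≤ n}.Finite :=
  ((List.finite_length_le (ι × Bool) n).image FreeGroup.mk).subset fun g hg =>
    ⟨g.toWord, hg, FreeGroup.mk_toWord⟩

theorem FreeGroup.exists_perm_ne_one {ι : Type*} [Finite ι] {g : FreeGroup ι} (hg : g ≠ 1) :
    ∃ (S : Set (FreeGroup ι)) (_ : Finite S) (π : FreeGroup ι →* Equiv.Perm S), π g ≠ 1 := by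
  classical
  let S : Set (FreeGroup ι) := {h | h.norm ≤ g.norm}
  have hS : Finite S := FreeGroup.finite_setOf_norm_le ι _
  have key : ∀ i : ι, ∃ σ : Equiv.Perm S, ∀ a b : S, (b : FreeGroup ι) = .of i * a → σ a = b := by
    intro i
    have : Fintype S := Fintype.ofFinite S
    let e : {a : S // FreeGroup.of i * (a : FreeGroup ι) ∈ S} ≃
        {b : S // (FreeGroup.of i)⁻¹ * (b : FreeGroup ι) ∈ S} :=
      { toFun := fun a => ⟨⟨_, a.2⟩, by simp⟩
        invFun := fun b => ⟨⟨_, b.2⟩, by simp⟩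
        left_inv := fun a => by ext; simp
        right_inv := fun b => by ext; simp }
    refine ⟨e.extendSubtype, fun a b hab => ?_⟩
    rw [e.extendSubtype_apply_of_mem a (hab ▸ b.2)]
    exact Subtype.ext hab.symm
  choose σ hσ using key
  refine ⟨S, hS, FreeGroup.lift σ, fun h1 => hg ?_⟩
  have one_mem : (1 : FreeGroup ι) ∈ S := by simp [S]
  have orbit : ∀ L : List (ι × Bool), (hL : L.length ≤ g.norm) →
      (FreeGroup.lift σ (FreeGroup.mk L) ⟨1, one_mem⟩ : FreeGroup ι) = FreeGroup.mk L := by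
    intro L
    induction L with
    | nil => intro hL; rw [← FreeGroup.one_eq_mk, _root_.map_one]; rfl
    | cons x L ih =>
      intro hL
      have hL' : L.length ≤ g.norm := (Nat.le_succ _).trans hL
      obtain ⟨i, b⟩ := x
      have hmul : FreeGroup.mk ((i, b) :: L) = FreeGroup.mk [(i, b)] * FreeGroup.mk L := by
        rw [FreeGroup.mul_mk]; rfl
      have hcons : FreeGroup.mk ((i, b) :: L) ∈ S := FreeGroup.norm_mk_le.trans hL
      have ih' := ih hL'
      rw [hmul] at hcons
      rw [hmul, _root_.map_mul, Equiv.Perm.mul_apply]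
      generalize FreeGroup.lift σ (FreeGroup.mk L) ⟨1, one_mem⟩ = a at ih'
      rw [← ih'] at hcons ⊢
      cases b
      · have hx : FreeGroup.mk [(i, false)] = (FreeGroup.of i)⁻¹ := rfl
        rw [hx] at hcons ⊢
        have hσa : (σ i)⁻¹ a = ⟨_, hcons⟩ :=
          Equiv.Perm.inv_eq_iff_eq.mpr (hσ i ⟨_, hcons⟩ a (by simp)).symm
        rw [_root_.map_inv, FreeGroup.lift_apply_of, hσa]
      · have hx : FreeGroup.mk [(i, true)] = FreeGroup.of i := rfl
        rw [hx] at hcons ⊢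
        rw [FreeGroup.lift_apply_of, hσ i a ⟨_, hcons⟩ rfl]
  have h := orbit g.toWord le_rfl
  rw [FreeGroup.mk_toWord, h1] at h
  exact h.symm

theorem Group.FG.finite_monoidHom (A Q : Type*) [Group A] [Group.FG A] [Group Q] [Finite Q] :
    Finite (A →* Q) := by
  obtain ⟨S, hS⟩ := Group.fg_def.mp ‹Group.FG A›
  refine Finite.of_injective (fun (f : A →* Q) (s : S) => f s) fun f g hfg => ?_
  exact MonoidHom.eq_of_eqOn_dense hS fun s hs => congrFun hfg ⟨s, hs⟩

theorem card_monoidHom_of_mulEquiv_freeGroup {A ι Q : Type*} [Group A] [Finite ι] [Group Q]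
    (e : A ≃* FreeGroup ι) : Nat.card (A →* Q) = Nat.card Q ^ Nat.card ι := by
  rw [Nat.card_congr e.monoidHomCongrLeftEquiv, ← Nat.card_congr FreeGroup.lift, Nat.card_fun]

theorem exists_mulEquiv_freeGroup_finite.{u} (A : Type u) [Group A] [IsFreeGroup A] [Group.FG A] :
    ∃ (ι : Type u) (_ : Finite ι), Nonempty (A ≃* FreeGroup ι) := by
  refine ⟨IsFreeGroup.Generators A, ?_, ⟨IsFreeGroup.toFreeGroup A⟩⟩
  have := Group.FG.finite_monoidHom A (Multiplicative (ZMod 2))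
  have := Finite.of_equiv _
    (IsFreeGroup.lift (G := A) (H := Multiplicative (ZMod 2))).symm
  classical
  refine Finite.of_injective (fun i : IsFreeGroup.Generators A =>
    (Pi.mulSingle i (Multiplicative.ofAdd 1) : _ → Multiplicative (ZMod 2))) fun i j hij => ?_
  by_contra hne
  have h := congrFun hij i
  simp only [Pi.mulSingle_eq_same, Pi.mulSingle_eq_of_ne hne] at h
  exact absurd h (by decide)

/-- The number of homomorphisms to the group of order two. For a free group of rank `n` this is
`2 ^ n`. -/
noncomputable def homCard (A : Type*) [Group A] : ℕ := Nat.card (A →* Multiplicative (ZMod 2))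

theorem comp_injective_of_surjective {A B Q : Type*} [Group A] [Group B] [Group Q] {f : A →* B}
    (hf : Function.Surjective f) : Function.Injective fun χ : B →* Q => χ.comp f :=
  fun _ _ h => (MonoidHom.cancel_right hf).mp h

theorem homCard_le_of_surjective {A B : Type*} [Group A] [Group.FG A] [Group B] {f : A →* B}
    (hf : Function.Surjective f) : homCard B ≤ homCard A :=
  have := Group.FG.finite_monoidHom A (Multiplicative (ZMod 2))
  Nat.card_le_card_of_injective _ (comp_injective_of_surjective hf)

theorem injective_of_surjective_of_homCard_le {A B : Type*} [Group A] [IsFreeGroup A] [Group.FG A]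
    [Group B] [IsFreeGroup B] {f : A →* B} (hf : Function.Surjective f)
    (h : homCard A ≤ homCard B) : Function.Injective f := by
  have : Group.FG B := Group.fg_of_surjective hf
  obtain ⟨ι, _, ⟨e⟩⟩ := exists_mulEquiv_freeGroup_finite A
  obtain ⟨κ, _, ⟨e'⟩⟩ := exists_mulEquiv_freeGroup_finite B
  have hle : Nat.card ι ≤ Nat.card κ := by
    unfold homCard at h
    rw [card_monoidHom_of_mulEquiv_freeGroup e, card_monoidHom_of_mulEquiv_freeGroup e'] at h
    exact (Nat.pow_le_pow_iff_right (by simp)).mp h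
  rw [injective_iff_map_eq_one]
  intro a ha
  by_contra ha1
  have : e a ≠ 1 := by simpa using ha1
  obtain ⟨S, _, π, hπ⟩ := FreeGroup.exists_perm_ne_one this
  have := Group.FG.finite_monoidHom A (Equiv.Perm S)
  have hbij := (comp_injective_of_surjective (Q := Equiv.Perm S) hf).bijective_of_nat_card_le (by
    rw [card_monoidHom_of_mulEquiv_freeGroup e, card_monoidHom_of_mulEquiv_freeGroup e']
    exact Nat.pow_le_pow_right Nat.card_pos hle)
  obtain ⟨χ, hχ⟩ := hbij.2 (π.comp e.toMonoidHom)
  apply hπ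
  have := DFunLike.congr_fun hχ a
  simpa [ha] using this.symm

end Hopfian

section ShortGenerators

theorem exists_minimal_norm_section {ι : Type*} [DecidableEq ι] (K : Subgroup (FreeGroup ι)) :
    ∃ τ : FreeGroup ι ⧸ K → FreeGroup ι, (∀ c, (τ c : FreeGroup ι ⧸ K) = c) ∧
      ∀ g : FreeGroup ι, (τ g).norm ≤ g.norm := by
  have key : ∀ c : FreeGroup ι ⧸ K, ∃ t : FreeGroup ι, (t : FreeGroup ι ⧸ K) = c ∧
      ∀ g : FreeGroup ι, (g : FreeGroup ι ⧸ K) = c → t.norm ≤ g.norm := by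
    intro c
    have hne : {g : FreeGroup ι | (g : FreeGroup ι ⧸ K) = c}.Nonempty :=
      QuotientGroup.mk_surjective c
    exact ⟨Function.argminOn FreeGroup.norm _ hne, Function.argminOn_mem FreeGroup.norm _ hne,
      fun g hg => Function.argminOn_le FreeGroup.norm _ hg⟩
  choose τ h₁ h₂ using key
  exact ⟨τ, h₁, fun g => h₂ _ g rfl⟩

/-- The elements of norm at most `n` in a subgroup of a free group generate a retract of it. -/
theorem exists_retraction_closure_norm_le {ι : Type*} [DecidableEq ι] (K : Subgroup (FreeGroup ι))
    (n : ℕ) : ∃ ρ : K →* Subgroup.closure {g | g ∈ K ∧ g.norm ≤ n},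
      ∀ k : K, (k : FreeGroup ι) ∈ Subgroup.closure {g | g ∈ K ∧ g.norm ≤ n} →
        (ρ k : FreeGroup ι) = k := by
  set J := Subgroup.closure {g | g ∈ K ∧ g.norm ≤ n} with hJ
  obtain ⟨τ, hτ, hτ_le⟩ := exists_minimal_norm_section K
  have τ_one : τ (1 : FreeGroup ι) = 1 := by
    have := hτ_le 1
    rwa [FreeGroup.norm_one, Nat.le_zero, FreeGroup.norm_eq_zero] at this
  have label : ∀ (i : ι) (c : FreeGroup ι ⧸ K), ∃ j : J,
      (τ c).norm + 1 + (τ (FreeGroup.of i • c)).norm ≤ n →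
        (j : FreeGroup ι) = (τ (FreeGroup.of i • c))⁻¹ * FreeGroup.of i * τ c := by
    intro i c
    by_cases h : (τ c).norm + 1 + (τ (FreeGroup.of i • c)).norm ≤ n
    · refine ⟨⟨(τ (FreeGroup.of i • c))⁻¹ * FreeGroup.of i * τ c,
        Subgroup.subset_closure ⟨?_, ?_⟩⟩, fun _ => rfl⟩
      · rw [mul_assoc, ← QuotientGroup.eq, hτ]
        conv_lhs => rw [← hτ c]
        rfl
      · refine (FreeGroup.norm_mul_le _ _).trans ?_
        have := FreeGroup.norm_mul_le (τ (FreeGroup.of i • c))⁻¹ (FreeGroup.of i)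
        rw [FreeGroup.norm_inv_eq, FreeGroup.norm_of] at this
        omega
    · exact ⟨1, fun h' => absurd h' h⟩
  choose ℓ hℓ using label
  let Λ : FreeGroup ι →* (FreeGroup ι ⧸ K → J) ⋊[mulAutArrow] FreeGroup ι :=
    FreeGroup.lift fun i => ⟨fun c => ℓ i ((FreeGroup.of i)⁻¹ • c), FreeGroup.of i⟩
  have Λ_right : ∀ g, (Λ g).right = g := by
    intro g
    have : SemidirectProduct.rightHom.comp Λ = MonoidHom.id _ := by
      ext i
      simp [Λ]
    exact DFunLike.congr_fun this g
  have Λ_mul : ∀ g h c, (Λ (g * h)).left c = (Λ g).left c * (Λ h).left (g⁻¹ • c) := by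
    intro g h c
    rw [map_mul, SemidirectProduct.mul_left, Λ_right]
    rfl
  have Λ_of : ∀ i c, (Λ (FreeGroup.of i)).left (FreeGroup.of i • c) = ℓ i c := by
    intro i c
    simp [Λ]
  have Λ_of_inv : ∀ i c, (Λ (FreeGroup.of i)⁻¹).left c = (ℓ i c)⁻¹ := by
    intro i c
    have := Λ_mul (FreeGroup.of i) (FreeGroup.of i)⁻¹ (FreeGroup.of i • c)
    rw [mul_inv_cancel, map_one, Λ_of, inv_smul_smul] at this
    exact (inv_eq_of_mul_eq_one_right this.symm).symm
  let o : FreeGroup ι ⧸ K := ((1 : FreeGroup ι) : FreeGroup ι ⧸ K)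
  have smul_o : ∀ g : FreeGroup ι, g • o = (g : FreeGroup ι ⧸ K) := fun g =>
    congrArg _ (mul_one g)
  have o_fixed : ∀ k : K, (k : FreeGroup ι)⁻¹ • o = o := by
    intro k
    rw [smul_o]
    exact QuotientGroup.eq.mpr (by simp)
  let ρ : K →* J :=
    { toFun := fun k => (Λ k).left o
      map_one' := by rw [OneMemClass.coe_one, map_one]; rfl
      map_mul' := fun k k' => by rw [Subgroup.coe_mul, Λ_mul, o_fixed] }
  have telescope : ∀ u p : List (ι × Bool), p.length + u.length ≤ n →
      FreeGroup.mk (p ++ u) ∈ K → ((Λ (FreeGroup.mk u)).left (FreeGroup.mk u • o) : FreeGroup ι) =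
        (τ (FreeGroup.mk u • o))⁻¹ * FreeGroup.mk u := by
    intro u
    induction u with
    | nil =>
      intro p _ _
      rw [← FreeGroup.one_eq_mk, map_one, one_smul, τ_one]
      simp
    | cons x u ih =>
      intro p hp hpK
      have ih' := ih (p ++ [x]) (by simp at hp ⊢; omega) (by simpa using hpK)
      have hu : (τ (FreeGroup.mk u • o)).norm ≤ u.length := by
        rw [smul_o]
        exact (hτ_le _).trans FreeGroup.norm_mk_le
      have hxu : (τ (FreeGroup.mk (x :: u) • o)).norm ≤ p.length := by
        have : FreeGroup.mk (x :: u) • o = ((FreeGroup.mk p)⁻¹ : FreeGroup ι) := by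
          rw [smul_o, eq_comm, QuotientGroup.eq, inv_inv, FreeGroup.mul_mk]
          exact hpK
        rw [this]
        refine (hτ_le _).trans ?_
        rw [FreeGroup.norm_inv_eq]
        exact FreeGroup.norm_mk_le
      have hmul : FreeGroup.mk (x :: u) = FreeGroup.mk [x] * FreeGroup.mk u := by
        rw [FreeGroup.mul_mk]; rfl
      rw [List.length_cons] at hp
      rw [hmul] at hxu ⊢
      rw [Λ_mul, mul_smul, inv_smul_smul, Subgroup.coe_mul, ih']
      rw [mul_smul] at hxu
      generalize FreeGroup.mk u • o = c at *
      obtain ⟨i, b⟩ := x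
      cases b
      · have hx : FreeGroup.mk [(i, false)] = (FreeGroup.of i)⁻¹ := rfl
        rw [hx] at hxu ⊢
        have := hℓ i ((FreeGroup.of i)⁻¹ • c) (by rw [smul_inv_smul]; omega)
        rw [Λ_of_inv, Subgroup.coe_inv, this, smul_inv_smul]
        group
      · have hx : FreeGroup.mk [(i, true)] = FreeGroup.of i := rfl
        rw [hx] at hxu ⊢
        rw [Λ_of, hℓ i c (by omega)]
        group
  refine ⟨ρ, fun k hk => ?_⟩
  have hJK : J ≤ K := (Subgroup.closure_le K).mpr fun g hg => hg.1
  suffices h : ∀ g : FreeGroup ι, ∀ hg : g ∈ J, (ρ ⟨g, hJK hg⟩ : FreeGroup ι) = g from h k hk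
  intro g hg
  induction hg using Subgroup.closure_induction with
  | mem g hg =>
    have h := telescope g.toWord [] (by simpa [FreeGroup.norm] using hg.2) (by simpa [FreeGroup.mk_toWord] using hg.1)
    rw [FreeGroup.mk_toWord] at h
    have hgo : g • o = o := by
      rw [smul_o]
      exact QuotientGroup.eq.mpr (by simpa using hg.1)
    rw [hgo, τ_one, inv_one, one_mul] at h
    exact h
  | one => exact congrArg Subtype.val (map_one ρ)
  | mul x y hx hy ihx ihy =>
    have := congrArg Subtype.val (map_mul ρ ⟨x, hJK hx⟩ ⟨y, hJK hy⟩)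
    rw [Subgroup.coe_mul, ihx, ihy] at this
    exact this
  | inv x hx ihx =>
    have := congrArg Subtype.val (map_inv ρ ⟨x, hJK hx⟩)
    rw [Subgroup.coe_inv, ihx] at this
    exact this

end ShortGenerators

section Retracts

/-- `H` is a retract of the ambient group. -/
def IsRetract {G : Type*} [Group G] (H : Subgroup G) : Prop :=
  ∃ ρ : G →* H, ∀ h : H, ρ h = h

theorem surjective_of_fixes_of_homCard_range_le {ι : Type*} [Finite ι] {X : Set (FreeGroup ι)}
    (hfin : X.Finite) (hX : ∀ W : Subgroup (FreeGroup ι), IsRetract W → X ⊆ W → W = ⊤)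
    {φ : FreeGroup ι →* FreeGroup ι} (hφ : ∀ x ∈ X, φ x = x)
    (hmin : ∀ ψ : FreeGroup ι →* FreeGroup ι, (∀ x ∈ X, ψ x = x) →
      homCard φ.range ≤ homCard ψ.range) : Function.Surjective φ := by
  classical
  obtain ⟨p, p_zero, p_succ⟩ : ∃ p : ℕ → FreeGroup ι →* FreeGroup ι,
      (∀ g, p 0 g = g) ∧ ∀ n g, p (n + 1) g = φ (p n g) :=
    ⟨fun n => Nat.rec (MonoidHom.id _) (fun _ f => φ.comp f) n, fun _ => rfl, fun _ _ => rfl⟩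
  have p_succ' : ∀ n g, p (n + 1) g = p n (φ g) := by
    intro n g
    induction n with
    | zero => rw [p_succ, p_zero, p_zero]
    | succ n ih => rw [p_succ, ih, ← p_succ]
  have p_add : ∀ m n g, p (m + n) g = p m (p n g) := by
    intro m n g
    induction n generalizing g with
    | zero => rw [p_zero]; rfl
    | succ n ih => rw [← add_assoc, p_succ', ih, ← p_succ']
  have p_fix : ∀ n, ∀ x ∈ X, p n x = x := by
    intro n x hx
    induction n with
    | zero => exact p_zero x
    | succ n ih => rw [p_succ, ih, hφ x hx]
  have anti : ∀ n, (p (n + 1)).range ≤ (p n).range := by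
    rintro n _ ⟨g, rfl⟩
    exact ⟨φ g, (p_succ' n g).symm⟩
  have card_le : ∀ n, homCard (p (n + 1)).range ≤ homCard φ.range := by
    intro n
    let f : φ.range →* (p (n + 1)).range :=
      ((p n).comp φ.range.subtype).codRestrict _ (by
        rintro ⟨_, g, rfl⟩
        exact ⟨g, p_succ' n g⟩)
    refine homCard_le_of_surjective (f := f) ?_
    rintro ⟨_, g, rfl⟩
    exact ⟨⟨φ g, g, rfl⟩, Subtype.ext (p_succ' n g).symm⟩
  obtain ⟨L, hL⟩ : ∃ L, ∀ x ∈ X, x.norm ≤ L := by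
    obtain ⟨L, hL⟩ := (hfin.image FreeGroup.norm).bddAbove
    exact ⟨L, fun x hx => hL ⟨x, hx, rfl⟩⟩
  let B : ℕ → Set (FreeGroup ι) := fun n => {g | g ∈ (p n).range ∧ g.norm ≤ L}
  have B_fin : ∀ n, (B n).Finite := fun n =>
    (FreeGroup.finite_setOf_norm_le ι L).subset fun g hg => hg.2
  obtain ⟨n, hn⟩ : ∃ n, B (n + 1) ⊆ B (n + 1 + 1) := by
    let m := Function.argmin (fun n => (B (n + 1)).ncard)
    have hm : (B (m + 1)).ncard ≤ (B (m + 1 + 1)).ncard :=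
      Function.argmin_le (fun n => (B (n + 1)).ncard) (m + 1)
    have hsub : B (m + 1 + 1) ⊆ B (m + 1) := fun g hg => ⟨anti _ hg.1, hg.2⟩
    exact ⟨m, (Set.eq_of_subset_of_ncard_le hsub hm (B_fin _)).ge⟩
  set N := n + 1 with hN
  obtain ⟨ρ, hρ⟩ := exists_retraction_closure_norm_le (p N).range L
  change (p N).range →* Subgroup.closure (B N) at ρ
  have J_le : Subgroup.closure (B N) ≤ (p N).range :=
    (Subgroup.closure_le _).mpr fun g hg => hg.1
  let ψ : FreeGroup ι →* FreeGroup ι :=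
    (Subgroup.subtype _).comp (ρ.comp (p N).rangeRestrict)
  have ψ_fix : ∀ x ∈ X, ψ x = x := by
    intro x hx
    have hpx : p N x = x := p_fix N x hx
    refine (hρ ((p N).rangeRestrict x) (Subgroup.subset_closure ⟨⟨x, rfl⟩, ?_⟩)).trans hpx
    exact (congrArg _ hpx).trans_le (hL x hx)
  have ψ_range : ψ.range = Subgroup.closure (B N) := by
    refine le_antisymm ?_ fun j hj => ?_
    · rintro _ ⟨g, rfl⟩
      exact (ρ _).2
    · obtain ⟨g, rfl⟩ := J_le hj
      exact ⟨g, hρ ⟨p N g, g, rfl⟩ hj⟩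
  have ρ_surj : Function.Surjective ρ := fun j => ⟨⟨j, J_le j.2⟩, Subtype.ext (hρ _ j.2)⟩
  have fgN : Group.FG (p N).range := Group.fg_of_surjective (p N).rangeRestrict_surjective
  have ρ_inj : Function.Injective ρ := injective_of_surjective_of_homCard_le ρ_surj (by
    rw [← ψ_range]
    exact (card_le n).trans (hmin ψ ψ_fix))
  have le_J : (p N).range ≤ Subgroup.closure (B N) := by
    intro k hk
    have : (⟨ρ ⟨k, hk⟩, J_le (ρ ⟨k, hk⟩).2⟩ : (p N).range) = ⟨k, hk⟩ :=
      ρ_inj (Subtype.ext (hρ _ (ρ ⟨k, hk⟩).2))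
    rw [← show _ = k from congrArg Subtype.val this]
    exact (ρ ⟨k, hk⟩).2
  have step : (p N).range ≤ (p (N + 1)).range :=
    le_J.trans ((Subgroup.closure_le _).mpr fun g hg => (hn hg).1)
  have stable : ∀ j, (p N).range ≤ (p (N + j)).range := by
    intro j
    induction j with
    | zero => exact le_rfl
    | succ j ih =>
      intro k hk
      obtain ⟨g, rfl⟩ := step hk
      obtain ⟨g', hg'⟩ := ih ⟨g, rfl⟩
      exact ⟨g', by rw [p_succ, ← hg', ← add_assoc, p_succ]⟩
  let β : (p N).range →* (p N).range := (p N).rangeRestrict.comp (Subgroup.subtype _)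
  have β_surj : Function.Surjective β := by
    rintro ⟨k, hk⟩
    obtain ⟨g, hg⟩ := stable N hk
    exact ⟨⟨p N g, g, rfl⟩, Subtype.ext ((p_add N N g).symm.trans hg)⟩
  have β_inj : Function.Injective β := injective_of_surjective_of_homCard_le β_surj le_rfl
  let e := MulEquiv.ofBijective β ⟨β_inj, β_surj⟩
  have htop : (p N).range = ⊤ := hX _
    ⟨e.symm.toMonoidHom.comp (p N).rangeRestrict, fun k => e.symm_apply_apply k⟩
    fun x hx => ⟨x, p_fix N x hx⟩
  intro g
  obtain ⟨g', rfl⟩ : g ∈ (p N).range := htop ▸ Subgroup.mem_top g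
  exact ⟨p n g', (p_succ n g').symm⟩

theorem FreeGroup.bijective_of_fixes {ι : Type*} [Finite ι] {X : Set (FreeGroup ι)}
    (hfin : X.Finite) (hX : ∀ W : Subgroup (FreeGroup ι), IsRetract W → X ⊆ W → W = ⊤)
    {φ : FreeGroup ι →* FreeGroup ι} (hφ : ∀ x ∈ X, φ x = x) : Function.Bijective φ := by
  let E : Set (FreeGroup ι →* FreeGroup ι) := {φ | ∀ x ∈ X, φ x = x}
  have hE : E.Nonempty := ⟨φ, hφ⟩
  obtain ⟨φ₀, h₀, hmin⟩ : ∃ φ₀ ∈ E, ∀ ψ ∈ E, homCard φ₀.range ≤ homCard ψ.range :=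
    ⟨_, Function.argminOn_mem _ _ hE, fun ψ hψ =>
      Function.argminOn_le (fun ψ : FreeGroup ι →* FreeGroup ι => homCard ψ.range) E hψ⟩
  have surj₀ := surjective_of_fixes_of_homCard_range_le hfin hX h₀ hmin
  have card₀ : homCard (FreeGroup ι) ≤ homCard φ₀.range := by
    rw [MonoidHom.range_eq_top.mpr surj₀]
    exact homCard_le_of_surjective (f := (Subgroup.topEquiv (G := FreeGroup ι)).toMonoidHom)
      Subgroup.topEquiv.surjective
  have surj : Function.Surjective φ := surjective_of_fixes_of_homCard_range_le hfin hX hφ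
    fun ψ hψ => (homCard_le_of_surjective φ.rangeRestrict_surjective).trans
      (card₀.trans (hmin ψ hψ))
  exact ⟨injective_of_surjective_of_homCard_le surj le_rfl, surj⟩

theorem IsRetract.comap {G G' : Type*} [Group G] [Group G'] (e : G ≃* G') {W : Subgroup G'}
    (hW : IsRetract W) : IsRetract (W.comap e.toMonoidHom) := by
  obtain ⟨ρ, hρ⟩ := hW
  refine ⟨((e.symm.toMonoidHom.comp (W.subtype.comp ρ)).comp e.toMonoidHom).codRestrict _
    fun g => ?_, fun h => Subtype.ext ?_⟩
  · simp
  · have := hρ ⟨e h, h.2⟩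
    change e.symm (ρ (e h)) = h
    rw [this, e.symm_apply_apply]

theorem bijective_of_fixes {A : Type*} [Group A] [IsFreeGroup A] [Group.FG A] {X : Set A}
    (hfin : X.Finite) (hX : ∀ W : Subgroup A, IsRetract W → X ⊆ W → W = ⊤)
    {φ : A →* A} (hφ : ∀ x ∈ X, φ x = x) : Function.Bijective φ := by
  obtain ⟨ι, _, ⟨e⟩⟩ := exists_mulEquiv_freeGroup_finite A
  have := FreeGroup.bijective_of_fixes (hfin.image e) (fun W hW hXW => ?_)
    (φ := (e.toMonoidHom.comp φ).comp e.symm.toMonoidHom) ?_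
  · have h := (e.symm.bijective.comp this).comp e.bijective
    convert h using 1
    ext a
    simp
  · have h := hX _ (hW.comap e) fun x hx => hXW ⟨x, hx, rfl⟩
    rw [eq_top_iff] at h ⊢
    intro g _
    simpa using h (Subgroup.mem_top (e.symm g))
  · rintro _ ⟨x, hx, rfl⟩
    simp [hφ x hx]

end Retracts

section TestWord

theorem exists_dihedralGroup_hom : ∃ χ : DihedralGroup 4 →* Multiplicative (ZMod 2),
    (∀ g, χ g = 1 → g ^ 2 = 1) ∧ χ (.r 1) ≠ 1 ∧ χ (.sr 0) ≠ 1 := by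
  let f : DihedralGroup 4 → Multiplicative (ZMod 2)
    | .r k => Multiplicative.ofAdd (ZMod.castHom (by norm_num : 2 ∣ 4) (ZMod 2) k)
    | .sr k => Multiplicative.ofAdd (ZMod.castHom (by norm_num : 2 ∣ 4) (ZMod 2) k + 1)
  exact ⟨⟨⟨f, by decide⟩, by decide⟩, by decide, by decide, by decide⟩

/-- The product of the squares of the elements of a list. -/
def squaresProd {ι G : Type*} [Group G] (x : ι → G) (l : List ι) : G :=
  (l.map fun i => x i ^ 2).prod

theorem map_squaresProd {ι G G' : Type*} [Group G] [Group G'] (f : G →* G') (x : ι → G)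
    (l : List ι) : f (squaresProd x l) = squaresProd (fun i => f (x i)) l := by
  simp [squaresProd, map_list_prod, Function.comp_def]

theorem squaresProd_eq_one {ι G : Type*} [Group G] {x : ι → G} (h : ∀ i, x i ^ 2 = 1)
    (l : List ι) : squaresProd x l = 1 := by
  simp [squaresProd, h]

theorem eq_one_of_ne_one_zmod_two {a b : Multiplicative (ZMod 2)} (ha : a ≠ 1) (hb : b ≠ 1) :
    a = b := by
  revert a b; decide

/-- The word `∏ xᵢ²` lies in no proper retract of the free group on the `xᵢ`. -/
theorem eq_top_of_squaresProd_mem {ι : Type*} [Finite ι] {l : List ι} (hl : l.Nodup)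
    (hmem : ∀ i, i ∈ l) {W : Subgroup (FreeGroup ι)} (hW : IsRetract W)
    (hv : squaresProd FreeGroup.of l ∈ W) : W = ⊤ := by
  classical
  obtain ⟨ρ, hρ⟩ := hW
  have ρ_surj : Function.Surjective ρ := fun w => ⟨w, hρ w⟩
  have fgW : Group.FG W := Group.fg_of_surjective ρ_surj
  have key : ∀ χ : FreeGroup ι →* Multiplicative (ZMod 2), (∀ w ∈ W, χ w = 1) → χ = 1 := by
    intro χ hχ
    by_contra hne
    obtain ⟨j, hj⟩ : ∃ j, χ (FreeGroup.of j) ≠ 1 := by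
      by_contra! h
      exact hne (FreeGroup.ext_hom _ _ h)
    obtain ⟨L, hker, hr, hs⟩ := exists_dihedralGroup_hom
    let θ : FreeGroup ι →* DihedralGroup 4 := FreeGroup.lift fun i =>
      if i = j then .r 1 else if χ (FreeGroup.of i) = 1 then 1 else .sr 0
    have hLθ : ∀ g, L (θ g) = χ g := by
      refine DFunLike.congr_fun (FreeGroup.ext_hom (L.comp θ) χ fun i => ?_)
      simp only [θ, MonoidHom.comp_apply, FreeGroup.lift_apply_of]
      split_ifs with h₁ h₂
      · subst h₁
        exact eq_one_of_ne_one_zmod_two hr hj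
      · rw [map_one, h₂]
      · exact eq_one_of_ne_one_zmod_two hs h₂
    have h₁ : θ (squaresProd FreeGroup.of l) = .r 2 := by
      rw [map_squaresProd, squaresProd, List.prod_map_eq_pow_single j, List.count_eq_one_of_mem hl (hmem j)]
      · simp only [θ, FreeGroup.lift_apply_of, if_true]
        decide
      · intro i hi _
        simp only [θ, FreeGroup.lift_apply_of, if_neg hi]
        split_ifs <;> decide
    have h₂ : squaresProd FreeGroup.of l = squaresProd (fun i => (ρ (FreeGroup.of i) : FreeGroup ι)) l := by
      have := congrArg W.subtype (hρ ⟨_, hv⟩)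
      simp only [Subgroup.subtype_apply] at this
      rw [← this]
      exact map_squaresProd (W.subtype.comp ρ) _ _
    rw [h₂, map_squaresProd, squaresProd_eq_one fun i => hker _ ?_] at h₁
    · revert h₁
      decide
    · rw [hLθ]
      exact hχ _ (ρ _).2
  have : Finite (W →* Multiplicative (ZMod 2)) := Group.FG.finite_monoidHom _ _
  have hcard : homCard (FreeGroup ι) ≤ homCard W := by
    refine Nat.card_le_card_of_injective (fun χ => χ.comp W.subtype) fun χ χ' h => ?_
    rw [← div_eq_one]
    refine key _ fun w hw => ?_
    rw [MonoidHom.div_apply, div_eq_one]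
    exact DFunLike.congr_fun h ⟨w, hw⟩
  have ρ_inj := injective_of_surjective_of_homCard_le ρ_surj hcard
  rw [eq_top_iff]
  intro g _
  rw [← ρ_inj (hρ (ρ g))]
  exact (ρ g).2

end TestWord

section Closed

theorem IsRetract.algClosedIn {G : Type*} [Group G] {H : Subgroup G} (hH : IsRetract H) :
    AlgClosedIn H := by
  obtain ⟨ρ, hρ⟩ := hH
  rintro n m S ⟨x, hx⟩
  refine ⟨fun j => ρ (x j), fun j => (ρ _).2, fun i => ?_⟩
  have : evalWord H (fun j => (ρ (x j) : G)) = (H.subtype.comp ρ).comp (evalWord H x) := by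
    refine FreeGroup.ext_hom _ _ ?_
    rintro (j | h)
    · simp [evalWord]
    · simp [evalWord, hρ]
  rw [this, MonoidHom.comp_apply, hx, map_one]

theorem AlgClosedIn.verballyClosedIn {G : Type*} [Group G] {H : Subgroup G}
    (hH : AlgClosedIn H) : VerballyClosedIn H := by
  intro n w h hh hx
  let w' : FreeGroup (Fin n ⊕ H) := FreeGroup.map Sum.inl w * (FreeGroup.of (Sum.inr ⟨h, hh⟩))⁻¹
  have key : ∀ x : Fin n → G, evalWord H x w' = 1 ↔ FreeGroup.lift x w = h := by
    intro x
    have : (evalWord H x).comp (FreeGroup.map Sum.inl) = FreeGroup.lift x := by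
      ext
      simp [evalWord]
    rw [← this]
    simp [w', evalWord, mul_inv_eq_one]
  simpa [key] using hH n 1 (fun _ => w') (by simpa [key] using hx)

theorem exists_lift_squaresProd_eq {G : Type*} [Group G] {g : G}
    (hg : g ∈ Subgroup.closure (Set.range fun x : G => x ^ 2)) :
    ∃ (n : ℕ) (x : Fin n → G), FreeGroup.lift x (squaresProd FreeGroup.of (List.finRange n)) = g := by
  suffices h : ∃ L : List G, squaresProd id L = g by
    obtain ⟨L, rfl⟩ := h
    refine ⟨L.length, L.get, ?_⟩
    rw [map_squaresProd]
    have hL : (List.finRange L.length).map L.get = L := by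
      rw [← List.ofFn_eq_map, List.ofFn_get]
    conv_rhs => rw [← hL]
    simp only [squaresProd, List.map_map, Function.comp_def, FreeGroup.lift_apply_of, id]
  induction hg using Subgroup.closure_induction with
  | mem g hg =>
    obtain ⟨x, rfl⟩ := hg
    exact ⟨[x], by simp [squaresProd]⟩
  | one => exact ⟨[], rfl⟩
  | mul x y _ _ hx hy =>
    obtain ⟨L, rfl⟩ := hx
    obtain ⟨M, rfl⟩ := hy
    exact ⟨L ++ M, by simp [squaresProd]⟩
  | inv x _ hx =>
    obtain ⟨L, rfl⟩ := hx
    refine ⟨(L.map (·⁻¹)).reverse, ?_⟩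
    simp [squaresProd, List.prod_inv_reverse, Function.comp_def, List.map_reverse]

theorem finite_quotient_closure_squares (G : Type*) [Group G] [Group.FG G] :
    Finite (G ⧸ Subgroup.closure (Set.range fun x : G => x ^ 2)) := by
  set S := Subgroup.closure (Set.range fun x : G => x ^ 2)
  have : S.Normal := by
    have sq_mem : ∀ x : G, x ^ 2 ∈ S := fun x => Subgroup.subset_closure ⟨x, rfl⟩
    refine ⟨fun n hn g => ?_⟩
    have : g * n * g⁻¹ = (g * n) ^ 2 * (n⁻¹ * g⁻¹ ^ 2) := by simp [pow_two, mul_assoc]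
    rw [this]
    exact S.mul_mem (sq_mem _) (S.mul_mem (S.inv_mem hn) (sq_mem _))
  have sq : ∀ q : G ⧸ S, q * q = 1 := by
    intro q
    induction q using QuotientGroup.induction_on with
    | H g =>
      rw [← QuotientGroup.mk_mul, QuotientGroup.eq_one_iff, ← pow_two]
      exact Subgroup.subset_closure ⟨g, rfl⟩
  have comm : ∀ a b : G ⧸ S, a * b = b * a := by
    intro a b
    have h := sq (a * b)
    have ha := inv_eq_of_mul_eq_one_right (sq a)
    have hb := inv_eq_of_mul_eq_one_right (sq b)
    have hab := inv_eq_of_mul_eq_one_right h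
    rw [← hab, mul_inv_rev, ha, hb]
  let _ : CommGroup (G ⧸ S) := { (inferInstance : Group (G ⧸ S)) with mul_comm := comm }
  exact CommGroup.finite_of_fg_isMulTorsion (G := G ⧸ S) fun q =>
    isOfFinOrder_iff_pow_eq_one.mpr ⟨2, by norm_num, by rw [pow_two, sq]⟩

theorem VerballyClosedIn.fg {G : Type*} [Group G] [Group.FG G] {H : Subgroup G} [IsFreeGroup H]
    (hH : VerballyClosedIn H) : Group.FG H := by
  classical
  let b : IsFreeGroup.Generators H → H := IsFreeGroup.of
  have : Finite (G ⧸ Subgroup.closure (Set.range fun x : G => x ^ 2)) :=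
    finite_quotient_closure_squares G
  have : Finite (IsFreeGroup.Generators H) := by
    refine Finite.of_injective (fun i => ((b i : G) :
      G ⧸ Subgroup.closure (Set.range fun x : G => x ^ 2))) fun i j hij => ?_
    by_contra hne
    obtain ⟨n, x, hx⟩ := exists_lift_squaresProd_eq (QuotientGroup.eq.mp hij)
    obtain ⟨y, hyH, hy⟩ := hH n _ _ ((b i)⁻¹ * b j).2 ⟨x, hx⟩
    rw [map_squaresProd] at hy
    let χ : H →* Multiplicative (ZMod 2) :=
      IsFreeGroup.lift fun k => if k = i then Multiplicative.ofAdd 1 else 1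
    have h₁ : squaresProd (fun k => (⟨y k, hyH k⟩ : H)) (List.finRange n) = (b i)⁻¹ * b j := by
      refine Subtype.ext (Eq.trans ?_ hy)
      rw [← Subgroup.subtype_apply, map_squaresProd]
      simp
    have h₂ := congrArg χ h₁
    rw [map_squaresProd, squaresProd_eq_one fun k => by
      generalize χ _ = a
      revert a
      decide] at h₂
    rw [map_mul, map_inv] at h₂
    simp only [χ, b, IsFreeGroup.lift_of, if_true, if_neg (Ne.symm hne)] at h₂
    exact absurd h₂ (by decide)
  exact Group.fg_of_surjective (f := (IsFreeGroup.toFreeGroup H).symm.toMonoidHom)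
    (IsFreeGroup.toFreeGroup H).symm.surjective

theorem VerballyClosedIn.isRetract {r : ℕ} {H : Subgroup (FreeGroup (Fin r))}
    (hH : VerballyClosedIn H) : IsRetract H := by
  have := hH.fg
  obtain ⟨ι, _, ⟨e⟩⟩ := exists_mulEquiv_freeGroup_finite H
  have := Fintype.ofFinite ι
  let l : List ι := Finset.univ.toList
  let h : H := e.symm (squaresProd FreeGroup.of l)
  obtain ⟨y, hyH, hy⟩ := hH r h h h.2 ⟨FreeGroup.of, FreeGroup.lift_of_apply _⟩
  let φ : FreeGroup (Fin r) →* H := FreeGroup.lift fun j => ⟨y j, hyH j⟩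
  have hφ : φ h = h := by
    refine Subtype.ext (Eq.trans ?_ hy)
    rw [← Subgroup.subtype_apply, ← MonoidHom.comp_apply]
    congr 1
    ext
    simp [φ]
  have hbij : Function.Bijective (φ.comp H.subtype) := by
    refine bijective_of_fixes (Set.finite_singleton h) (fun W hW hmem => ?_) (by simpa using hφ)
    have htop := eq_top_of_squaresProd_mem (Finset.nodup_toList _) (by simp [l])
      (hW.comap e.symm) (l := l) (hmem rfl)
    rw [eq_top_iff] at htop ⊢
    intro g _
    simpa using htop (Subgroup.mem_top (e g))
  let α := MulEquiv.ofBijective _ hbij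
  exact ⟨α.symm.toMonoidHom.comp φ, fun h => α.symm_apply_apply h⟩

theorem verballyClosedIn_iff_isRetract {r : ℕ} {H : Subgroup (FreeGroup (Fin r))} :
    VerballyClosedIn H ↔ IsRetract H :=
  ⟨fun h => h.isRetract, fun h => h.algClosedIn.verballyClosedIn⟩

theorem algClosedIn_iff_isRetract {r : ℕ} {H : Subgroup (FreeGroup (Fin r))} :
    AlgClosedIn H ↔ IsRetract H :=
  ⟨fun h => h.verballyClosedIn.isRetract, fun h => h.algClosedIn⟩

end Closed

section TurningPoint

theorem FreeGroup.IsReduced.norm_mk {ι : Type*} [DecidableEq ι] {L : List (ι × Bool)}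
    (h : FreeGroup.IsReduced L) : (FreeGroup.mk L).norm = L.length := by
  rw [FreeGroup.norm, FreeGroup.toWord_mk, h.reduce_eq]

theorem FreeGroup.mk_cons {ι : Type*} (y : ι × Bool) (L : List (ι × Bool)) :
    FreeGroup.mk (y :: L) = FreeGroup.mk [y] * FreeGroup.mk L := by
  rw [FreeGroup.mul_mk]; rfl

/-- A non-constant function on a free group of finite rank that is almost invariant under left
translations stabilises along the words issuing from some point `z` which avoid a letter `b`. -/
theorem exists_turning_point {ι S : Type*} [Finite ι] [DecidableEq ι] {f : FreeGroup ι → S}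
    (hne : ∃ g h, f g ≠ f h) (hfin : ∀ g, {h | f (g * h) ≠ f h}.Finite) :
    ∃ (z : FreeGroup ι) (b : ι × Bool), (∃ y, y ≠ b ∧ f (FreeGroup.mk [y] * z) ≠ f z) ∧
      ∀ u : List (ι × Bool), FreeGroup.IsReduced u → u.getLast? ≠ some b →
        f (FreeGroup.mk u * z) = f (FreeGroup.mk u.getLast?.toList * z) := by
  let C : Set (FreeGroup ι) := {h | ∃ y : ι × Bool, f (FreeGroup.mk [y] * h) ≠ f h ∧
    (FreeGroup.mk [y] * h).norm = h.norm + 1}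
  have hCfin : C.Finite :=
    (Set.finite_iUnion fun y : ι × Bool => hfin (FreeGroup.mk [y])).subset fun h ⟨y, hy, _⟩ =>
      Set.mem_iUnion.mpr ⟨y, hy⟩
  have eq_of_notMem : ∀ (y : ι × Bool) (L : List (ι × Bool)), FreeGroup.IsReduced (y :: L) →
      FreeGroup.mk L ∉ C → f (FreeGroup.mk (y :: L)) = f (FreeGroup.mk L) := by
    intro y L hL hC
    by_contra hyL
    refine hC ⟨y, by rwa [← FreeGroup.mk_cons], ?_⟩
    rw [← FreeGroup.mk_cons, hL.norm_mk, (hL.infix (List.suffix_cons y L).isInfix).norm_mk]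
    rfl
  have hCne : C.Nonempty := by
    by_contra hC
    rw [Set.not_nonempty_iff_eq_empty] at hC
    have const : ∀ L : List (ι × Bool), FreeGroup.IsReduced L → f (FreeGroup.mk L) = f 1 := by
      intro L
      induction L with
      | nil => intro _; rfl
      | cons y L ih =>
        intro hL
        rw [eq_of_notMem y L hL (by simp [hC]), ih (hL.infix (List.suffix_cons y L).isInfix)]
    obtain ⟨g, h, hgh⟩ := hne
    apply hgh
    have := const _ (FreeGroup.isReduced_toWord (x := g))
    have := const _ (FreeGroup.isReduced_toWord (x := h))
    simp_all [FreeGroup.mk_toWord]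
  obtain ⟨z, ⟨p, hp, hpz⟩, hmax⟩ := Set.exists_max_image C FreeGroup.norm hCfin hCne
  obtain ⟨b, hpb, hb⟩ : ∃ b : ι × Bool, p ≠ b ∧
      ∀ y, y ≠ b → FreeGroup.IsReduced (y :: z.toWord) := by
    have hz := FreeGroup.isReduced_toWord (x := z)
    rcases hzw : z.toWord with _ | ⟨β, t⟩
    · exact ⟨(p.1, !p.2), fun h => by simpa using congrArg Prod.snd h,
        fun y _ => FreeGroup.IsReduced.singleton⟩
    · refine ⟨(β.1, !β.2), ?_, fun y hy => ?_⟩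
      · rintro rfl
        have h₁ : FreeGroup.mk [(β.1, !β.2)] * z = FreeGroup.mk t := by
          rw [← FreeGroup.mk_toWord (x := z), hzw, FreeGroup.mk_cons β, ← mul_assoc]
          have : FreeGroup.mk [(β.1, !β.2)] = (FreeGroup.mk [β])⁻¹ := by
            rw [FreeGroup.inv_mk]; rfl
          rw [this, inv_mul_cancel, one_mul]
        have h₂ : z.norm = t.length + 1 := by rw [FreeGroup.norm, hzw]; rfl
        have h₃ : (FreeGroup.mk t).norm ≤ t.length := FreeGroup.norm_mk_le
        rw [h₁, h₂] at hpz
        omega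
      · rw [hzw] at hz
        refine List.isChain_cons_cons.mpr ⟨fun h => ?_, hz⟩
        by_contra h'
        exact hy (Prod.ext h (Bool.eq_not.mpr h'))
  refine ⟨z, b, ⟨p, hpb, hp⟩, fun u hu hub => ?_⟩
  rcases List.eq_nil_or_concat u with rfl | ⟨v, y, rfl⟩
  · rfl
  simp only [List.concat_eq_append, List.getLast?_append, List.getLast?_singleton,
    Option.some_or, ne_eq, Option.some.injEq, Option.toList_some] at hu hub ⊢
  have hred : FreeGroup.IsReduced (v ++ y :: z.toWord) := List.isChain_split.mpr ⟨hu, hb y hub⟩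
  have mul_z : ∀ L : List (ι × Bool), FreeGroup.mk L * z = FreeGroup.mk (L ++ z.toWord) := by
    intro L
    rw [← FreeGroup.mul_mk, FreeGroup.mk_toWord]
  simp only [mul_z, List.append_assoc, List.singleton_append]
  clear hu
  induction v with
  | nil => rfl
  | cons x v ih =>
    rw [List.cons_append] at hred ⊢
    have hred' := hred.infix (List.suffix_cons x _).isInfix
    rw [eq_of_notMem _ _ hred, ih hred']
    intro hC
    have := hmax _ hC
    rw [hred'.norm_mk, FreeGroup.norm] at this
    simp at this
    omega

end TurningPoint

section Twist

/-- `TurnsAll R e L` says that `R` holds for all turns of the word `L` preceded by the letter `e`,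
a turn being a letter together with the inverse of the letter that follows it. -/
def TurnsAll {ι : Type*} (R : Option (ι × Bool) → Option (ι × Bool) → Prop) :
    Option (ι × Bool) → List (ι × Bool) → Prop
  | e, [] => R e none
  | e, y :: L => R e (some (y.1, !y.2)) ∧ TurnsAll R (some y) L

theorem turnsAll_of_forall_append {ι : Type*}
    {R : Option (ι × Bool) → Option (ι × Bool) → Prop} {w : List (ι × Bool)}
    (h : ∀ u v, u ++ v = w → R u.getLast? (FreeGroup.invRev v).getLast?) : TurnsAll R none w := by
  suffices H : ∀ v u, u ++ v = w → TurnsAll R u.getLast? v from H w [] rfl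
  intro v
  induction v with
  | nil => exact fun u hu => h u [] hu
  | cons y v ih =>
    intro u hu
    have h₁ := h u (y :: v) hu
    have h₂ := ih (u ++ [y]) (by simpa using hu)
    rw [List.getLast?_concat] at h₂
    exact ⟨by simpa [FreeGroup.invRev] using h₁, h₂⟩

/-- The number of turns of `L`, preceded by `e`, at which the potential `ζ` jumps. -/
def jumps {ι : Type*} (ζ : Option (ι × Bool) → ℤ) : Option (ι × Bool) → List (ι × Bool) → ℕ
  | e, [] => if ζ e = ζ none then 0 else 1
  | e, y :: L => (if ζ e = ζ (some (y.1, !y.2)) then 0 else 1) + jumps ζ (some y) L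

theorem turnsAll_of_jumps_eq_zero {ι : Type*} {ζ : Option (ι × Bool) → ℤ}
    {e : Option (ι × Bool)} {L : List (ι × Bool)} (h : jumps ζ e L = 0) :
    TurnsAll (fun e e' => ζ e = ζ e') e L := by
  induction L generalizing e with
  | nil =>
    change ζ e = ζ none
    simpa [jumps] using h
  | cons y L ih =>
    rw [jumps, Nat.add_eq_zero_iff] at h
    exact ⟨by simpa using h.1, ih h.2⟩

/-- The endomorphism sending each letter `y` to `c ^ (-ζ(y⁻¹)) * y * c ^ ζ(y)`. -/
def twist {ι : Type*} (c : FreeGroup ι) (ζ : Option (ι × Bool) → ℤ) :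
    FreeGroup ι →* FreeGroup ι :=
  FreeGroup.lift fun i => c ^ (-ζ (some (i, false))) * FreeGroup.of i * c ^ ζ (some (i, true))

theorem twist_mk_singleton {ι : Type*} (c : FreeGroup ι) (ζ : Option (ι × Bool) → ℤ)
    (y : ι × Bool) : twist c ζ (FreeGroup.mk [y]) =
      c ^ (-ζ (some (y.1, !y.2))) * FreeGroup.mk [y] * c ^ ζ (some y) := by
  obtain ⟨i, b⟩ := y
  have h : twist c ζ (FreeGroup.of i) =
      c ^ (-ζ (some (i, false))) * FreeGroup.of i * c ^ ζ (some (i, true)) :=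
    FreeGroup.lift_apply_of ..
  cases b
  · have hi : FreeGroup.mk [(i, false)] = (FreeGroup.of i)⁻¹ := rfl
    rw [hi, map_inv, h]
    simp [mul_assoc]
  · exact h

theorem twist_mk_eq_of_turnsAll {ι : Type*} (c : FreeGroup ι) {ζ : Option (ι × Bool) → ℤ}
    (h0 : ζ none = 0) {e : Option (ι × Bool)} {L : List (ι × Bool)}
    (h : TurnsAll (fun e e' => ζ e = ζ e') e L) :
    c ^ ζ e * twist c ζ (FreeGroup.mk L) = FreeGroup.mk L := by
  induction L generalizing e with
  | nil =>
    rw [show ζ e = 0 from h.trans h0, ← FreeGroup.one_eq_mk, map_one, zpow_zero, one_mul]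
  | cons y L ih =>
    have h₁ : ζ e = _ := h.1
    rw [FreeGroup.mk_cons, map_mul, twist_mk_singleton, h₁, mul_assoc (_ * _), ih h.2, ← mul_assoc,
      ← mul_assoc, ← zpow_add, add_neg_cancel, zpow_zero, one_mul]

theorem norm_mk_singleton_mul_le {ι : Type*} [DecidableEq ι] (y : ι × Bool) (g : FreeGroup ι) :
    (FreeGroup.mk [y] * g).norm ≤ g.norm + 1 := by
  have h₁ : (FreeGroup.mk [y]).norm ≤ 1 := FreeGroup.norm_mk_le
  have h₂ := FreeGroup.norm_mul_le (FreeGroup.mk [y]) g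
  omega

theorem mk_singleton_inv {ι : Type*} (y : ι × Bool) :
    FreeGroup.mk [(y.1, !y.2)] = (FreeGroup.mk [y])⁻¹ := by
  rw [FreeGroup.inv_mk]; rfl

theorem norm_twist_add_jumps_le {ι : Type*} [DecidableEq ι] {b : ι × Bool}
    {ζ : Option (ι × Bool) → ℤ} {m : ℤ} (hn : ζ none = 0) (hb : ζ (some b) = m)
    (hb' : ζ (some (b.1, !b.2)) = m) (hζ : ∀ e, ζ e = m ∨ ζ e = m + 1)
    {e : Option (ι × Bool)} {L : List (ι × Bool)}
    (h : TurnsAll (fun e e' => e ≠ some b → e' ≠ some b → ζ e = ζ e') e L) :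
    (e ≠ some b → (FreeGroup.mk [b] ^ ζ e * twist (FreeGroup.mk [b]) ζ (FreeGroup.mk L)).norm +
      jumps ζ e L ≤ L.length) ∧
    (e = some b → (FreeGroup.mk [b] * (FreeGroup.mk [b] ^ ζ e *
      twist (FreeGroup.mk [b]) ζ (FreeGroup.mk L))).norm + jumps ζ e L ≤ L.length + 1) := by
  set c := FreeGroup.mk [b] with hc
  induction L generalizing e with
  | nil =>
    rw [← FreeGroup.one_eq_mk, map_one, mul_one, jumps]
    refine ⟨fun he => ?_, ?_⟩
    · have : ζ e = ζ none := h he (by simp)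
      rw [if_pos this, this, hn, zpow_zero, FreeGroup.norm_one]
      rfl
    · rintro rfl
      split_ifs with h₁
      · rw [h₁, hn, zpow_zero]
        exact norm_mk_singleton_mul_le b 1
      · have : ζ (some b) = -1 := by
          rcases hζ none with h₂ | h₂ <;> omega
        rw [this, zpow_neg_one, mul_inv_cancel, FreeGroup.norm_one]
        rfl
  | cons y L ih =>
    set t := FreeGroup.mk [y] * (c ^ ζ (some y) * twist c ζ (FreeGroup.mk L)) with ht
    have ht_le : t.norm + jumps ζ (some y) L ≤ L.length + 1 := by
      by_cases hy : y = b
      · subst hy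
        exact (ih h.2).2 rfl
      · have h₁ := (ih h.2).1 (by simpa using hy)
        have h₂ : t.norm ≤ (c ^ ζ (some y) * twist c ζ (FreeGroup.mk L)).norm + 1 :=
          norm_mk_singleton_mul_le y _
        omega
    have expand : c ^ ζ e * twist c ζ (FreeGroup.mk (y :: L)) =
        c ^ (ζ e - ζ (some (y.1, !y.2))) * t := by
      rw [FreeGroup.mk_cons, map_mul, twist_mk_singleton, sub_eq_add_neg, zpow_add, ht]
      simp only [mul_assoc]
    rw [expand, jumps, List.length_cons]
    refine ⟨fun he => ?_, ?_⟩
    · split_ifs with h₁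
      · rw [h₁, sub_self, zpow_zero, one_mul]
        omega
      · have hyb : (y.1, !y.2) = b := by
          by_contra hyb
          exact h₁ (h.1 he (by simpa using hyb))
        rw [hyb] at h₁ ⊢
        have hy : y = (b.1, !b.2) := by rw [← hyb]; simp
        have hne : y ≠ b := by
          rw [hy]
          exact fun h => by simpa using congrArg Prod.snd h
        have hd : ζ e - ζ (some b) = 1 := by
          rcases hζ e with h₂ | h₂ <;> omega
        have h₂ := (ih h.2).1 (by simpa using hne)
        have h₃ : c * t = c ^ ζ (some y) * twist c ζ (FreeGroup.mk L) := by
          rw [ht, hy, mk_singleton_inv, mul_inv_cancel_left]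
        rw [hd, zpow_one, h₃]
        omega
    · rintro rfl
      split_ifs with h₁
      · rw [h₁, sub_self, zpow_zero, one_mul]
        have : (c * t).norm ≤ t.norm + 1 := norm_mk_singleton_mul_le b t
        omega
      · have hd : ζ (some b) - ζ (some (y.1, !y.2)) = -1 := by
          rcases hζ (some (y.1, !y.2)) with h₂ | h₂ <;> omega
        rw [hd, zpow_neg_one, mul_inv_cancel_left]
        omega

theorem twist_neg_twist {ι : Type*} {b : ι × Bool} {ζ : Option (ι × Bool) → ℤ}
    (hb : ζ (some b) = ζ (some (b.1, !b.2))) (g : FreeGroup ι) :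
    twist (FreeGroup.mk [b]) (-ζ) (twist (FreeGroup.mk [b]) ζ g) = g := by
  have fix : twist (FreeGroup.mk [b]) (-ζ) (FreeGroup.mk [b]) = FreeGroup.mk [b] := by
    rw [twist_mk_singleton]
    simp only [Pi.neg_apply, neg_neg, ← hb]
    rw [← zpow_add_one, ← zpow_add, add_neg_cancel_comm, zpow_one]
  refine DFunLike.congr_fun (FreeGroup.ext_hom ((twist _ (-ζ)).comp (twist _ ζ))
    (MonoidHom.id _) fun i => ?_) g
  have hi : FreeGroup.of i = FreeGroup.mk [(i, true)] := rfl
  simp only [MonoidHom.comp_apply, MonoidHom.id_apply, hi, twist_mk_singleton, map_mul, map_zpow,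
    fix, Pi.neg_apply, neg_neg, Bool.not_true]
  group

end Twist

section Shortening

theorem not_injective_of_map_eq_one {G : Type*} [Group G] {φ : G →* G} {g : G} (hg : g ≠ 1)
    (h : φ g = 1) : ¬ Function.Bijective φ := fun hφ =>
  hg (hφ.1 (h.trans (map_one φ).symm))

theorem mk_singleton_ne_one {ι : Type*} (y : ι × Bool) : FreeGroup.mk [y] ≠ 1 := by
  classical
  intro h
  have := (FreeGroup.IsReduced.singleton (a := y)).norm_mk
  rw [h, FreeGroup.norm_one] at this
  exact absurd this (by simp)

theorem exists_not_bijective_of_turnsAll {ι : Type*} [DecidableEq ι] {κ : Type*}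
    {x : κ → FreeGroup ι} {ζ : Option (ι × Bool) → ℤ} (hn : ζ none = 0)
    (hζ : ∀ e, ζ e = 0 ∨ ζ e = 1 ∨ ζ e = -1) {p : ι × Bool} (hp : ζ (some p) ≠ 0)
    (h : ∀ k, TurnsAll (fun e e' => ζ e = ζ e') none (x k).toWord) :
    ∃ φ : FreeGroup ι →* FreeGroup ι, ¬ Function.Bijective φ ∧ ∀ k, φ (x k) = x k := by
  have hfix : ∀ c k, twist c ζ (x k) = x k := by
    intro c k
    have := twist_mk_eq_of_turnsAll c hn (h k)
    rwa [FreeGroup.mk_toWord, hn, zpow_zero, one_mul] at this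
  by_cases hall : ∃ q : ι × Bool, ζ (some q) ≠ 0 ∧ ζ (some (q.1, !q.2)) = 0
  · obtain ⟨q, hq, hq'⟩ := hall
    refine ⟨twist (FreeGroup.mk [q] ^ (-ζ (some q))) ζ, ?_, hfix _⟩
    refine not_injective_of_map_eq_one (mk_singleton_ne_one q) ?_
    rw [twist_mk_singleton, hq', neg_zero, zpow_zero, one_mul, ← zpow_mul]
    rcases hζ (some q) with h₁ | h₁ | h₁
    · exact absurd h₁ hq
    · rw [h₁, show (-1 * 1 : ℤ) = -1 by norm_num, zpow_neg_one, mul_inv_cancel]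
    · rw [h₁, show (- -1 * -1 : ℤ) = -1 by norm_num, zpow_neg_one, mul_inv_cancel]
  · push Not at hall
    have hall' : ∀ q : ι × Bool, ζ (some q) = 0 → ζ (some (q.1, !q.2)) = 0 := by
      intro q hq
      by_contra h'
      exact hall _ h' (by simpa using hq)
    let φ : FreeGroup ι →* FreeGroup ι :=
      FreeGroup.lift fun i => if ζ (some (i, true)) = 0 then FreeGroup.of i else 1
    have φ_pos : ∀ y : ι × Bool, ζ (some y) = 0 → φ (FreeGroup.mk [y]) = FreeGroup.mk [y] := by
      rintro ⟨i, b⟩ hy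
      cases b
      · have hi : FreeGroup.mk [(i, false)] = (FreeGroup.of i)⁻¹ := rfl
        have := hall' _ hy
        simp only [Bool.not_false] at this
        rw [hi, map_inv, FreeGroup.lift_apply_of, if_pos this]
      · exact (FreeGroup.lift_apply_of ..).trans (if_pos hy)
    refine ⟨φ, ?_, fun k => ?_⟩
    · refine not_injective_of_map_eq_one (g := FreeGroup.of p.1)
        (mk_singleton_ne_one (p.1, true)) ?_
      rw [FreeGroup.lift_apply_of, if_neg]
      obtain ⟨i, b⟩ := p
      cases b
      · exact hall _ hp
      · exact hp
    · have key : ∀ (L : List (ι × Bool)) (e), TurnsAll (fun e e' => ζ e = ζ e') e L →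
          ζ e = 0 ∧ φ (FreeGroup.mk L) = FreeGroup.mk L := by
        intro L
        induction L with
        | nil =>
          intro e he
          exact ⟨Eq.trans he hn, map_one φ⟩
        | cons y L ih =>
          rintro e ⟨he, hL⟩
          obtain ⟨hy, hφL⟩ := ih _ hL
          refine ⟨he.trans (hall' y hy), ?_⟩
          rw [FreeGroup.mk_cons, map_mul, hφL, φ_pos y hy]
      have := (key _ _ (h k)).2
      rwa [FreeGroup.mk_toWord] at this

/-- There is a potential on letters that is constant along the turns of every element of the
stabiliser of `f`, up to the turns involving one letter `b`. -/
theorem exists_potential {ι S : Type*} [Finite ι] [DecidableEq ι] {f : FreeGroup ι → S}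
    (hne : ∃ g h, f g ≠ f h) (hfin : ∀ g, {h | f (g * h) ≠ f h}.Finite) :
    ∃ (b : ι × Bool) (ζ : Option (ι × Bool) → ℤ) (m : ℤ), ζ none = 0 ∧ ζ (some b) = m ∧
      ζ (some (b.1, !b.2)) = m ∧ (∀ e, ζ e = m ∨ ζ e = m + 1) ∧ (∃ p, ζ (some p) ≠ 0) ∧
      ∀ x : FreeGroup ι, (∀ h, f (x * h) = f h) →
        TurnsAll (fun e e' => e ≠ some b → e' ≠ some b → ζ e = ζ e') none x.toWord := by
  classical
  obtain ⟨z, b, ⟨p, hpb, hp⟩, hz⟩ := exists_turning_point hne hfin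
  let P : Option (ι × Bool) → Prop := fun e => f (FreeGroup.mk e.toList * z) ≠ f z
  have P_none : ¬ P none := not_not.mpr (congrArg f (one_mul z))
  have hP : ∀ x : FreeGroup ι, (∀ h, f (x * h) = f h) →
      TurnsAll (fun e e' => e ≠ some b → e' ≠ some b → (P e ↔ P e')) none x.toWord := by
    intro x hx
    refine turnsAll_of_forall_append fun u v huv he he' => ?_
    have hred := FreeGroup.isReduced_toWord (x := x)
    rw [← huv] at hred
    have hv : FreeGroup.IsReduced (FreeGroup.invRev v) := by
      rw [FreeGroup.isReduced_iff_reduce_eq, FreeGroup.reduce_invRev,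
        (hred.infix (List.suffix_append u v).isInfix).reduce_eq]
    have h₁ := hz u (hred.infix (List.prefix_append u v).isInfix) he
    have h₂ := hz _ hv he'
    have h₃ := hx (FreeGroup.mk (FreeGroup.invRev v) * z)
    rw [← FreeGroup.mk_toWord (x := x), ← huv, ← FreeGroup.mul_mk, ← FreeGroup.inv_mk, mul_assoc,
      mul_inv_cancel_left, FreeGroup.inv_mk, h₁, h₂] at h₃
    simp only [P, h₃]
  have mono : ∀ {R R' : Option (ι × Bool) → Option (ι × Bool) → Prop}, (∀ e e', R e e' → R' e e') →
      ∀ (L : List (ι × Bool)) (e), TurnsAll R e L → TurnsAll R' e L := by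
    intro R R' hRR' L
    induction L with
    | nil => exact fun e h => hRR' _ _ h
    | cons y L ih => exact fun e h => ⟨hRR' _ _ h.1, ih _ h.2⟩
  by_cases hb : P (some (b.1, !b.2))
  · refine ⟨b, fun e => if P e ∨ e = some b then -1 else 0, -1, by simp [P_none], by simp,
      by simp [hb], fun e => ?_, ⟨p, ?_⟩, fun x hx => mono (fun e e' h he he' => ?_) _ _ (hP x hx)⟩
    · dsimp only
      split_ifs <;> simp
    · have : P (some p) := hp
      simp [this]
    · simp [he, he', h he he']
  · refine ⟨b, fun e => if P e ∧ e ≠ some b then 1 else 0, 0, by simp [P_none], by simp,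
      by simp [hb], fun e => ?_, ⟨p, ?_⟩, fun x hx => mono (fun e e' h he he' => ?_) _ _ (hP x hx)⟩
    · dsimp only
      split_ifs <;> simp
    · have : P (some p) := hp
      simp [this, hpb]
    · simp [he, he', h he he']

/-- If a non-constant almost invariant function on a free group of finite rank is invariant under
finitely many elements, these are fixed by an endomorphism which is not bijective. -/
theorem exists_not_bijective_fixing {ι S κ : Type*} [Finite ι] [Fintype κ] (f : FreeGroup ι → S)
    (hne : ∃ g h, f g ≠ f h) (hfin : ∀ g, {h | f (g * h) ≠ f h}.Finite) (x : κ → FreeGroup ι)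
    (hx : ∀ k h, f (x k * h) = f h) :
    ∃ φ : FreeGroup ι →* FreeGroup ι, ¬ Function.Bijective φ ∧ ∀ k, φ (x k) = x k := by
  classical
  induction hN : ∑ k, (x k).norm using Nat.strong_induction_on generalizing f x with
  | _ N ih =>
  obtain ⟨b, ζ, m, hn, hb, hb', hζ, ⟨p, hp⟩, hturn⟩ := exists_potential hne hfin
  have norm_le : ∀ k, (twist (FreeGroup.mk [b]) ζ (x k)).norm + jumps ζ none (x k).toWord ≤
      (x k).norm := by
    intro k
    have := (norm_twist_add_jumps_le hn hb hb' hζ (hturn (x k) (hx k))).1 (by simp)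
    rwa [FreeGroup.mk_toWord, hn, zpow_zero, one_mul] at this
  by_cases hj : ∀ k, jumps ζ none (x k).toWord = 0
  · refine exists_not_bijective_of_turnsAll hn (fun e => ?_) hp
      fun k => turnsAll_of_jumps_eq_zero (hj k)
    rcases hζ none with h₁ | h₁ <;> rcases hζ e with h₂ | h₂ <;> omega
  · push Not at hj
    obtain ⟨k₀, hk₀⟩ := hj
    have hbb := hb.trans hb'.symm
    let σ : FreeGroup ι ≃* FreeGroup ι := MonoidHom.toMulEquiv (twist (FreeGroup.mk [b]) ζ)
      (twist (FreeGroup.mk [b]) (-ζ)) (MonoidHom.ext (twist_neg_twist hbb))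
      (MonoidHom.ext fun g => by
        have := twist_neg_twist (ζ := -ζ) (b := b) (by simpa using hbb) g
        rwa [neg_neg] at this)
    have hσ : ∀ k, (σ (x k)).norm + jumps ζ none (x k).toWord ≤ (x k).norm := norm_le
    have hlt : ∑ k, (σ (x k)).norm < N := by
      rw [← hN]
      refine Finset.sum_lt_sum (fun k _ => ?_) ⟨k₀, Finset.mem_univ _, ?_⟩
      · have := hσ k
        omega
      · have := hσ k₀
        omega
    have hne' : ∃ g h, (f ∘ σ.symm) g ≠ (f ∘ σ.symm) h := by
      obtain ⟨g, h, hgh⟩ := hne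
      exact ⟨σ g, σ h, by simpa using hgh⟩
    have hfin' : ∀ g, {h | (f ∘ σ.symm) (g * h) ≠ (f ∘ σ.symm) h}.Finite := fun g => by
      refine ((hfin (σ.symm g)).preimage σ.symm.injective.injOn).subset fun h hh => ?_
      simpa using hh
    have hx' : ∀ k h, (f ∘ σ.symm) (σ (x k) * h) = (f ∘ σ.symm) h := fun k h => by
      simpa using hx k (σ.symm h)
    obtain ⟨φ, hφ, hφx⟩ := ih _ hlt _ hne' hfin' (fun k => σ (x k)) hx' rfl
    refine ⟨(σ.symm.toMonoidHom.comp φ).comp σ.toMonoidHom, fun hbij => hφ ?_, fun k => ?_⟩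
    · convert (σ.bijective.comp hbij).comp σ.symm.bijective using 1
      ext g
      simp
    · have := hφx k
      simp [this]

end Shortening

section Sections

/-- The endomorphism of a free group killing the generators outside `B`. -/
noncomputable def killOutside {β : Type*} (B : Set β) : FreeGroup β →* FreeGroup β :=
  open Classical in FreeGroup.lift fun b => if b ∈ B then FreeGroup.of b else 1

theorem exists_finite_killOutside_eq {β : Type*} (n : FreeGroup β) :
    ∃ B : Set β, B.Finite ∧ ∀ C, B ⊆ C → killOutside C n = n := by
  induction n using FreeGroup.induction_on with
  | C1 => exact ⟨∅, Set.finite_empty, fun _ _ => map_one _⟩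
  | of b =>
    exact ⟨{b}, Set.finite_singleton b, fun C hC => by
      rw [killOutside, FreeGroup.lift_apply_of, if_pos (hC rfl)]⟩
  | inv_of b ih =>
    obtain ⟨B, hB, h⟩ := ih
    exact ⟨B, hB, fun C hC => by rw [map_inv, h C hC]⟩
  | mul x y hx hy =>
    obtain ⟨B, hB, h⟩ := hx
    obtain ⟨B', hB', h'⟩ := hy
    exact ⟨B ∪ B', hB.union hB', fun C hC => by
      rw [map_mul, h C (Set.subset_union_left.trans hC), h' C (Set.subset_union_right.trans hC)]⟩

/-- The action of `G` on the free group on `G × J` by translations of the generators. -/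
noncomputable def translateAut (G J : Type*) [Group G] : G →* MulAut (FreeGroup (G × J)) where
  toFun g := FreeGroup.freeGroupCongr ((Equiv.mulLeft g).prodCongr (Equiv.refl J))
  map_one' := by
    ext n
    simp
  map_mul' g h := by
    ext n
    induction n using FreeGroup.induction_on with
    | C1 => simp
    | of b => simp [mul_assoc, Prod.map]
    | inv_of b ih => rw [map_inv, ih, map_inv]
    | mul x y hx hy => rw [map_mul, hx, hy, map_mul]

theorem translateAut_of {G J : Type*} [Group G] (g : G) (b : G × J) :
    translateAut G J g (FreeGroup.of b) = FreeGroup.of (g * b.1, b.2) := by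
  simp [translateAut, Prod.map]

theorem finite_setOf_killOutside_translateAut_ne_one {G J : Type*} [Group G] {B : Set (G × J)}
    (hB : B.Finite) (n : FreeGroup (G × J)) :
    {h : G | killOutside B (translateAut G J h⁻¹ n) ≠ 1}.Finite := by
  induction n using FreeGroup.induction_on with
  | C1 => simp
  | of b =>
    have hinj : Function.Injective fun h : G => (h⁻¹ * b.1, b.2) := fun h h' hh => by
      simpa using hh
    refine (hB.preimage hinj.injOn).subset fun h hh => ?_
    by_contra hb
    rw [Set.mem_preimage] at hb
    exact hh (by rw [translateAut_of, killOutside, FreeGroup.lift_apply_of, if_neg hb])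
  | inv_of b ih => simpa using ih
  | mul x y hx hy =>
    refine (hx.union hy).subset fun h hh => ?_
    by_contra hxy
    simp only [Set.mem_union, Set.mem_ofPred_eq, not_or, not_not] at hxy
    exact hh (by rw [map_mul, map_mul, hxy.1, hxy.2, one_mul])

/-- The Magnus embedding relative to a homomorphism `p`. -/
noncomputable def magnus {G J : Type*} [Group G] (p : FreeGroup J →* G) :
    FreeGroup J →* FreeGroup (G × J) ⋊[translateAut G J] G :=
  FreeGroup.lift fun j => ⟨FreeGroup.of (1, j), p (FreeGroup.of j)⟩

theorem magnus_right {G J : Type*} [Group G] (p : FreeGroup J →* G) (w : FreeGroup J) :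
    (magnus p w).right = p w := by
  have : SemidirectProduct.rightHom.comp (magnus p) = p := by
    ext j
    simp [magnus]
  exact DFunLike.congr_fun this w

theorem magnus_injective {G J : Type*} [Group G] (p : FreeGroup J →* G) :
    Function.Injective (magnus p) := by
  let R : FreeGroup (G × J) ⋊[translateAut G J] G →* FreeGroup J :=
    SemidirectProduct.lift (FreeGroup.map Prod.snd) 1 fun g => by
      ext b
      simp [translateAut_of]
  have : R.comp (magnus p) = MonoidHom.id _ := by
    ext j
    rw [MonoidHom.comp_apply, magnus, FreeGroup.lift_apply_of, SemidirectProduct.mk_eq_inl_mul_inr]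
    simp [R]
  exact Function.LeftInverse.injective (g := R) (DFunLike.congr_fun this)

/-- Two sections of a homomorphism between free groups agree as soon as they agree on a finite set
fixed only by bijective endomorphisms. -/
theorem sections_eq {ι J : Type*} [Finite ι] (p : FreeGroup J →* FreeGroup ι)
    {s t : FreeGroup ι →* FreeGroup J} (hs : ∀ g, p (s g) = g) (ht : ∀ g, p (t g) = g)
    {X : Set (FreeGroup ι)} (hfin : X.Finite)
    (hX : ∀ φ : FreeGroup ι →* FreeGroup ι, (∀ x ∈ X, φ x = x) → Function.Bijective φ)
    (hst : ∀ x ∈ X, s x = t x) : s = t := by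
  by_contra hne
  obtain ⟨x, hx⟩ : ∃ x, s x ≠ t x := by
    contrapose! hne
    exact MonoidHom.ext hne
  let n : FreeGroup ι → FreeGroup (FreeGroup ι × J) := fun h =>
    ((magnus p (s h))⁻¹ * magnus p (t h)).left
  have hn : ∀ h, SemidirectProduct.inl (n h) = (magnus p (s h))⁻¹ * magnus p (t h) := fun h =>
    SemidirectProduct.ext rfl (by simp [magnus_right, hs, ht])
  have n_eq : ∀ h, s h = t h → n h = 1 := fun h hh => by simp [n, hh]
  have n_ne : n x ≠ 1 := fun h => hx (magnus_injective p (by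
    have := hn x
    rwa [h, map_one, eq_comm, inv_mul_eq_one] at this))
  have n_mul : ∀ g h, n (g * h) = translateAut _ _ h⁻¹
      ((magnus p (s h)).left⁻¹ * n g * (magnus p (s h)).left) * n h := by
    intro g h
    apply SemidirectProduct.inl_injective (φ := translateAut (FreeGroup ι) J)
    have hsplit : magnus p (s h) = SemidirectProduct.inl (magnus p (s h)).left *
        SemidirectProduct.inr h := by
      rw [← SemidirectProduct.mk_eq_inl_mul_inr]
      exact SemidirectProduct.ext rfl (by simp [magnus_right, hs])
    rw [map_mul, SemidirectProduct.inl_aut, hn (g * h), map_mul, map_mul, map_mul, map_mul, hn h]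
    simp only [map_mul, map_inv, hn g]
    generalize (magnus p (s h)).left = a at hsplit
    rw [hsplit]
    group
  obtain ⟨B, hB, hBx⟩ := exists_finite_killOutside_eq (n x)
  have hBx := hBx B le_rfl
  have _ := hfin.fintype
  have hne' : ∃ g h, killOutside B (n g) ≠ killOutside B (n h) :=
    ⟨x, 1, by rwa [hBx, n_eq 1 (by simp), map_one]⟩
  have hfin' : ∀ g, {h | killOutside B (n (g * h)) ≠ killOutside B (n h)}.Finite := fun g => by
    refine (finite_setOf_killOutside_translateAut_ne_one hB (n g)).subset fun h hh h₁ => hh ?_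
    simp only [map_inv] at h₁
    simp only [n_mul, map_mul, map_inv, h₁, mul_one, inv_mul_cancel, one_mul]
  have hinv : ∀ (k : X) h, killOutside B (n (k * h)) = killOutside B (n h) := fun k h => by
    simp [n_mul, n_eq _ (hst _ k.2)]
  obtain ⟨φ, hφ, hφX⟩ := exists_not_bijective_fixing _ hne' hfin' _ hinv
  exact hφ (hX φ fun x hx => hφX ⟨x, hx⟩)

end Sections

section LeastRetract

theorem sections_eq_of_isFreeGroup {A J : Type*} [Group A] [IsFreeGroup A] [Group.FG A]
    (p : FreeGroup J →* A) {s t : A →* FreeGroup J} (hs : ∀ g, p (s g) = g)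
    (ht : ∀ g, p (t g) = g) {X : Set A} (hfin : X.Finite)
    (hX : ∀ φ : A →* A, (∀ x ∈ X, φ x = x) → Function.Bijective φ)
    (hst : ∀ x ∈ X, s x = t x) : s = t := by
  obtain ⟨ι, _, ⟨e⟩⟩ := exists_mulEquiv_freeGroup_finite A
  have key : s.comp e.symm.toMonoidHom = t.comp e.symm.toMonoidHom := by
    refine sections_eq (e.toMonoidHom.comp p) (by simp [hs]) (by simp [ht]) (hfin.image e)
      (fun φ hφ => ?_) (by simpa using hst)
    have h := hX ((e.symm.toMonoidHom.comp φ).comp e.toMonoidHom) fun x hx => by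
      simp [hφ _ ⟨x, hx, rfl⟩]
    convert (e.bijective.comp h).comp e.symm.bijective using 1
    ext g
    simp
  ext g
  simpa using DFunLike.congr_fun key (e g)

variable {G : Type*} [Group G]

theorem IsRetract.homCard_le [Group.FG G] {V : Subgroup G} (hV : IsRetract V) :
    homCard V ≤ homCard G := by
  obtain ⟨ρ, hρ⟩ := hV
  exact homCard_le_of_surjective (f := ρ) fun v => ⟨v, hρ v⟩

theorem IsRetract.fg [Group.FG G] {V : Subgroup G} (hV : IsRetract V) : Group.FG V := by
  obtain ⟨ρ, hρ⟩ := hV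
  exact Group.fg_of_surjective (f := ρ) fun v => ⟨v, hρ v⟩

theorem isRetract_top : IsRetract (⊤ : Subgroup G) :=
  ⟨Subgroup.topEquiv.symm.toMonoidHom, fun _ => rfl⟩

theorem IsRetract.map_subtype {V : Subgroup G} (hV : IsRetract V) {U : Subgroup V}
    (hU : IsRetract U) : IsRetract (U.map V.subtype) := by
  obtain ⟨ρ, hρ⟩ := hV
  obtain ⟨σ, hσ⟩ := hU
  refine ⟨((V.subtype.comp U.subtype).comp (σ.comp ρ)).codRestrict _ fun g =>
    ⟨σ (ρ g), (σ (ρ g)).2, rfl⟩, ?_⟩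
  rintro ⟨_, u, hu, rfl⟩
  refine Subtype.ext ?_
  change ((σ (ρ u) : V) : G) = u
  rw [hρ u, hσ ⟨u, hu⟩]

theorem IsRetract.eq_of_le {J : Type*} [Finite J] {U V : Subgroup (FreeGroup J)}
    (hU : IsRetract U) (hV : IsRetract V) (hUV : U ≤ V) (h : homCard V ≤ homCard U) : U = V := by
  have _ := hV.fg
  obtain ⟨ρ, hρ⟩ := hU
  have surj : Function.Surjective (ρ.comp V.subtype) := fun u => ⟨⟨u, hUV u.2⟩, hρ u⟩
  have inj := injective_of_surjective_of_homCard_le surj h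
  refine le_antisymm hUV fun v hv => ?_
  have : (⟨ρ v, hUV (ρ v).2⟩ : V) = ⟨v, hv⟩ := inj (hρ (ρ v))
  rw [← show _ = v from congrArg Subtype.val this]
  exact (ρ v).2

theorem IsRetract.le_of_forall_homCard_le {J : Type*} [Finite J] {V W : Subgroup (FreeGroup J)}
    (hV : IsRetract V) (hW : IsRetract W) {X : Set (FreeGroup J)} (hfin : X.Finite)
    (hXV : X ⊆ V) (hXW : X ⊆ W)
    (hmin : ∀ U : Subgroup (FreeGroup J), IsRetract U → X ⊆ U → homCard V ≤ homCard U) :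
    V ≤ W := by
  have _ := hV.fg
  have hfin' : (Subtype.val ⁻¹' X : Set V).Finite := hfin.preimage Subtype.val_injective.injOn
  have bij : ∀ φ : V →* V, (∀ x ∈ (Subtype.val ⁻¹' X : Set V), φ x = x) →
      Function.Bijective φ := by
    refine fun φ hφ => bijective_of_fixes hfin' (fun U hU hXU => ?_) hφ
    have hUV : U.map V.subtype ≤ V := by
      rintro _ ⟨u, -, rfl⟩
      exact u.2
    have := (hV.map_subtype hU).eq_of_le hV hUV
      (hmin _ (hV.map_subtype hU) fun x hx => ⟨⟨x, hXV hx⟩, hXU hx, rfl⟩)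
    rw [eq_top_iff]
    rintro ⟨v, hv⟩ -
    rw [← this] at hv
    obtain ⟨u, hu, rfl⟩ := hv
    exact hu
  obtain ⟨ρ, hρ⟩ := hV
  obtain ⟨ρ', hρ'⟩ := hW
  let τ : V →* FreeGroup J := (W.subtype.comp ρ').comp V.subtype
  have τ_fix : ∀ x ∈ (Subtype.val ⁻¹' X : Set V), τ x = x := fun x hx =>
    congrArg Subtype.val (hρ' ⟨x, hXW hx⟩)
  have α_fix : ∀ x ∈ (Subtype.val ⁻¹' X : Set V), ρ.comp τ x = x := fun x hx => by
    rw [MonoidHom.comp_apply, τ_fix x hx, hρ]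
  let α := MulEquiv.ofBijective _ (bij _ α_fix)
  have key : V.subtype = τ.comp α.symm.toMonoidHom := by
    refine sections_eq_of_isFreeGroup ρ hρ (fun g => α.apply_symm_apply g) hfin' bij fun x hx => ?_
    have : α.symm x = x := (MulEquiv.symm_apply_eq α).mpr (α_fix x hx).symm
    change (x : FreeGroup J) = τ (α.symm x)
    rw [this, τ_fix x hx]
  intro v hv
  have hτ : v = τ (α.symm ⟨v, hv⟩) := DFunLike.congr_fun key (⟨v, hv⟩ : V)
  rw [hτ]
  exact (ρ' _).2

theorem exists_least_isRetract_of_finite {J : Type*} [Finite J] {X : Set (FreeGroup J)}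
    (hfin : X.Finite) : ∃ V : Subgroup (FreeGroup J), IsRetract V ∧ X ⊆ V ∧
      ∀ W : Subgroup (FreeGroup J), IsRetract W → X ⊆ W → V ≤ W := by
  let E : Set (Subgroup (FreeGroup J)) := {V | IsRetract V ∧ X ⊆ V}
  have hE : E.Nonempty := ⟨⊤, isRetract_top, fun _ _ => trivial⟩
  obtain ⟨hV, hXV⟩ := Function.argminOn_mem (fun V : Subgroup (FreeGroup J) => homCard V) E hE
  exact ⟨_, hV, hXV, fun W hW hXW => hV.le_of_forall_homCard_le hW hfin hXV hXW fun U hU hXU =>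
    Function.argminOn_le (fun V : Subgroup (FreeGroup J) => homCard V) E ⟨hU, hXU⟩⟩

theorem exists_least_isRetract {J : Type*} [Finite J] (H : Subgroup (FreeGroup J)) :
    ∃ V : Subgroup (FreeGroup J), IsRetract V ∧ H ≤ V ∧
      ∀ W : Subgroup (FreeGroup J), IsRetract W → H ≤ W → V ≤ W := by
  classical
  choose V hV hXV hmin using fun X : Finset (FreeGroup J) =>
    exists_least_isRetract_of_finite X.finite_toSet
  let E : Set (Finset (FreeGroup J)) := {X | (X : Set (FreeGroup J)) ⊆ H}
  have hE : E.Nonempty := ⟨∅, by simp [E]⟩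
  let d : Finset (FreeGroup J) → ℕ := fun X => homCard (FreeGroup J) - homCard (V X)
  obtain ⟨X, hXH, hX⟩ : ∃ X ∈ E, ∀ Y ∈ E, d X ≤ d Y :=
    ⟨_, Function.argminOn_mem d E hE, fun Y hY => Function.argminOn_le d E hY⟩
  refine ⟨V X, hV X, fun h hh => ?_, fun W hW hHW => hmin X W hW (hXH.trans hHW)⟩
  have hins : insert h X ∈ E := by
    simpa [E, Set.insert_subset_iff] using And.intro hh hXH
  have hle : V X ≤ V (insert h X) := hmin X _ (hV _) fun x hx =>
    hXV _ (Finset.mem_coe.mpr (Finset.mem_insert_of_mem hx))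
  have hcard : homCard (V (insert h X)) ≤ homCard (V X) := by
    have h₁ := hX _ hins
    have h₂ := (hV X).homCard_le
    have h₃ := (hV (insert h X)).homCard_le
    simp only [d] at h₁
    omega
  rw [(hV X).eq_of_le (hV _) hle hcard]
  exact hXV _ (Finset.mem_coe.mpr (Finset.mem_insert_self h X))

end LeastRetract

/-- Every subgroup `H` of a free group of finite rank has a unique minimal
verbally closed subgroup containing it, which is also the unique minimal
algebraically closed subgroup containing `H`. -/
theorem exists_verbal_closure {r : ℕ} (H : Subgroup (FreeGroup (Fin r))) :
    ∃! V : Subgroup (FreeGroup (Fin r)),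
      (VerballyClosedIn V ∧ H ≤ V ∧
        ∀ W : Subgroup (FreeGroup (Fin r)), VerballyClosedIn W → H ≤ W → V ≤ W) ∧
      (AlgClosedIn V ∧ H ≤ V ∧
        ∀ W : Subgroup (FreeGroup (Fin r)), AlgClosedIn W → H ≤ W → V ≤ W) := by
  simp only [verballyClosedIn_iff_isRetract, algClosedIn_iff_isRetract, and_self]
  obtain ⟨V, hV, hHV, hmin⟩ := exists_least_isRetract H
  exact ⟨V, ⟨hV, hHV, hmin⟩, fun W hW => le_antisymm (hW.2.2 V hV hHV) (hmin W hW.1 hW.2.1)⟩
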